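/- arXiv:1709.06679 — 6 statements merged into one kernel-verified Lean document; each statement's English description precedes it below -/
import Mathlib

section
/- If a signed graph is structurally balanced with gauge σ, then the signed Laplacian annihilates the gauge vector: L.mulVec σ = 0; in particular 0 is an eigenvalue of the signed Laplacian with eigenvector σ ≠ 0. (Lemma 1, direction (2) ⇒ (4).) -/
/-- In a balanced signed graph, switching an edge weight by the gauge gives its absolute value. -/
theorem mul_gauge_eq_abs_mul_gauge {s t w : ℝ} (hs : s = 1 ∨ s = -1) (ht : t = 1 ∨ t = -1)
    (h : 0 ≤ s * t * w) : w * t = |w| * s := by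
  rcases hs with rfl | rfl <;> rcases ht with rfl | rfl
  · rw [abs_of_nonneg (by linarith)]
  · rw [abs_of_nonpos (by linarith)]; ring
  · rw [abs_of_nonpos (by linarith)]; ring
  · rw [abs_of_nonneg (by linarith)]

/-- Lemma 1, (2) ⇒ (4): if a signed graph is structurally balanced with gauge `σ`,
then the signed Laplacian annihilates the gauge vector, so `0` is an eigenvalue
with eigenvector `σ ≠ 0`. -/
theorem balanced_imp_laplacian_kernel
    (n : ℕ) (hn : 0 < n) (a : Fin n → Fin n → ℝ)
    (hsym : ∀ i j, a i j = a j i) (hdiag : ∀ i, a i i = 0)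
    (σ : Fin n → ℝ) (hgauge : ∀ i, σ i = 1 ∨ σ i = -1)
    (hbal : ∀ i j, σ i * σ j * a i j ≥ 0)
    (L : Matrix (Fin n) (Fin n) ℝ)
    (hL : ∀ i j, L i j = if i = j then ∑ k, |a i k| else -(a i j)) :
    L.mulVec σ = 0 ∧ σ ≠ 0 := by
  refine ⟨?_, fun h => ?_⟩
  · ext i
    have hentry : ∀ j, L i j * σ j =
        (if i = j then (∑ k, |a i k|) * σ i else 0) - |a i j| * σ i := by
      intro j
      rw [hL, ← mul_gauge_eq_abs_mul_gauge (hgauge i) (hgauge j) (hbal i j)]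
      split_ifs with hij
      · subst hij
        simp [hdiag]
      · ring
    simp [Matrix.mulVec, dotProduct, hentry, Finset.sum_sub_distrib, Finset.sum_mul]
  · have h0 := hgauge ⟨0, hn⟩
    simp [h] at h0
end

section
/- Let a signed graph be structurally balanced with gauge σ and let f : ℝ → ℝ be odd (f (-t) = -f t for all t). Then the gauge transformation z ↦ σ ⊙ z converts the signed absolute nonlinear flow into the unsigned absolute nonlinear flow: for every z : Fin n → ℝ and every vertex i, σ i * F (σ ⊙ z) i = -∑_{j : a i j ≠ 0} (f (z i) - f (z j)), where (σ ⊙ z) j = σ j * z j. (Key identity in the proof of Theorem 4, odd case.) -/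
/-- An odd function commutes with multiplication by a sign. -/
lemma odd_apply_sign_mul {f : ℝ → ℝ} (hodd : ∀ t, f (-t) = -f t) {s : ℝ}
    (hs : s = 1 ∨ s = -1) (t : ℝ) : f (s * t) = s * f t := by
  rcases hs with rfl | rfl <;> simp [hodd]

/-- In a balanced gauge, the sign of a nonzero weight is the product of the endpoint gauges. -/
lemma sign_eq_mul_of_balanced {s t w : ℝ} (hs : s = 1 ∨ s = -1) (ht : t = 1 ∨ t = -1)
    (hbal : s * t * w ≥ 0) (hw : w ≠ 0) : Real.sign w = s * t := by
  rcases lt_or_gt_of_ne hw with h | h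
  · rw [Real.sign_of_neg h]
    rcases hs with rfl | rfl <;> rcases ht with rfl | rfl <;> linarith
  · rw [Real.sign_of_pos h]
    rcases hs with rfl | rfl <;> rcases ht with rfl | rfl <;> linarith

/-- Key identity in the proof of Theorem 4, odd case: on a structurally balanced graph,
the gauge transformation turns the signed absolute nonlinear flow (with odd `f`) into
the unsigned absolute nonlinear flow. -/
theorem gauge_transforms_absolute_flow_odd
    (n : ℕ) (a : Fin n → Fin n → ℝ)
    (hsym : ∀ i j, a i j = a j i) (hdiag : ∀ i, a i i = 0)
    (σ : Fin n → ℝ) (hgauge : ∀ i, σ i = 1 ∨ σ i = -1)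
    (hbal : ∀ i j, σ i * σ j * a i j ≥ 0)
    (f : ℝ → ℝ) (hodd : ∀ t, f (-t) = -f t)
    (F : (Fin n → ℝ) → (Fin n → ℝ))
    (hF : ∀ x i, F x i =
      -∑ j ∈ Finset.univ.filter (fun j => a i j ≠ 0),
        (f (x i) - Real.sign (a i j) * f (x j)))
    (z : Fin n → ℝ) (i : Fin n) :
    σ i * F (fun j => σ j * z j) i =
      -∑ j ∈ Finset.univ.filter (fun j => a i j ≠ 0), (f (z i) - f (z j)) := by
  have hsq : ∀ k, σ k * σ k = 1 := fun k => mul_self_eq_one_iff.mpr (hgauge k)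
  rw [hF, mul_neg, Finset.mul_sum]
  congr 1
  refine Finset.sum_congr rfl fun j hj => ?_
  rw [sign_eq_mul_of_balanced (hgauge i) (hgauge j) (hbal i j) (Finset.mem_filter.mp hj).2,
    odd_apply_sign_mul hodd (hgauge i), odd_apply_sign_mul hodd (hgauge j)]
  linear_combination (f (z i) - σ j * σ j * f (z j)) * hsq i - f (z j) * hsq j
end

section
/- Let a signed graph be structurally balanced with gauge σ, let f : ℝ → ℝ be even (f (-t) = f t for all t), and let φ be an unsigned automorphism that preserves edge signs, i.e. sgn (a (φ i) (φ j)) = sgn (a i j) for all i, j. Then the signed absolute nonlinear flow F is invariant under the induced signed automorphism: for every x : Fin n → ℝ and every vertex i, F (Φ' x) i = F x (φ i). (Theorem 4, even case.) -/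
/-- Theorem 4, even case: on a structurally balanced graph, the signed absolute
nonlinear flow with even `f` is invariant under the signed automorphism induced by an
unsigned automorphism that preserves edge signs. -/
theorem absolute_flow_signed_automorphism_invariant_even
    (n : ℕ) (a : Fin n → Fin n → ℝ)
    (hsym : ∀ i j, a i j = a j i) (hdiag : ∀ i, a i i = 0)
    (σ : Fin n → ℝ) (hgauge : ∀ i, σ i = 1 ∨ σ i = -1)
    (hbal : ∀ i j, σ i * σ j * a i j ≥ 0)
    (f : ℝ → ℝ) (heven : ∀ t, f (-t) = f t)
    (φ : Equiv.Perm (Fin n))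
    (haut : ∀ i j, |a (φ i) (φ j)| = |a i j|)
    (hsgn : ∀ i j, Real.sign (a (φ i) (φ j)) = Real.sign (a i j))
    (F : (Fin n → ℝ) → (Fin n → ℝ))
    (hF : ∀ x i, F x i =
      -∑ j ∈ Finset.univ.filter (fun j => a i j ≠ 0),
        (f (x i) - Real.sign (a i j) * f (x j)))
    (x : Fin n → ℝ) (i : Fin n) :
    F (fun k => σ k * σ (φ k) * x (φ k)) i = F x (φ i) := by
  have hf : ∀ k, f (σ k * σ (φ k) * x (φ k)) = f (x (φ k)) := by
    intro k
    rcases hgauge k with h | h <;> rcases hgauge (φ k) with h' | h' <;> simp [h, h', heven]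
  have hne : ∀ j, a (φ i) (φ j) ≠ 0 ↔ a i j ≠ 0 := by
    intro j
    rw [← abs_ne_zero, haut, abs_ne_zero]
  rw [hF, hF]
  congr 1
  refine Finset.sum_equiv φ (fun j => ?_) (fun j _ => ?_)
  · simp only [Finset.mem_filter, Finset.mem_univ, true_and, hne]
  · simp only [hf, hsgn]
end

section
/- Let a signed graph be structurally balanced with gauge σ and let f : ℝ → ℝ be odd (f (-t) = -f t for all t). Then the gauge transformation z ↦ σ ⊙ z converts the signed relative nonlinear flow into the unsigned relative nonlinear flow: for every z : Fin n → ℝ and every vertex i, σ i * F (σ ⊙ z) i = -∑_{j : a i j ≠ 0} f (z i - z j), where (σ ⊙ z) j = σ j * z j. (Key identity in the proof of Theorem 5, odd case.) -/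
/-- Key identity in the proof of Theorem 5, odd case: on a structurally balanced graph,
the gauge transformation turns the signed relative nonlinear flow (with odd `f`) into
the unsigned relative nonlinear flow. -/
theorem gauge_transforms_relative_flow_odd
    (n : ℕ) (a : Fin n → Fin n → ℝ)
    (hsym : ∀ i j, a i j = a j i) (hdiag : ∀ i, a i i = 0)
    (σ : Fin n → ℝ) (hgauge : ∀ i, σ i = 1 ∨ σ i = -1)
    (hbal : ∀ i j, σ i * σ j * a i j ≥ 0)
    (f : ℝ → ℝ) (hodd : ∀ t, f (-t) = -f t)
    (F : (Fin n → ℝ) → (Fin n → ℝ))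
    (hF : ∀ x i, F x i =
      -∑ j ∈ Finset.univ.filter (fun j => a i j ≠ 0),
        f (x i - Real.sign (a i j) * x j))
    (z : Fin n → ℝ) (i : Fin n) :
    σ i * F (fun j => σ j * z j) i =
      -∑ j ∈ Finset.univ.filter (fun j => a i j ≠ 0), f (z i - z j) := by
  rw [hF, mul_neg, Finset.mul_sum]
  congr 1
  refine Finset.sum_congr rfl fun j hj => ?_
  have hne : a i j ≠ 0 := (Finset.mem_filter.mp hj).2
  have hsign : Real.sign (a i j) = σ i * σ j := by
    have h := hbal i j
    rcases hgauge i with hi | hi <;> rcases hgauge j with hj' | hj' <;>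
      rw [hi, hj'] at h ⊢ <;> rcases lt_or_gt_of_ne hne with ha | ha <;>
      first
        | (exfalso; linarith)
        | (rw [Real.sign_of_pos ha]; norm_num)
        | (rw [Real.sign_of_neg ha]; norm_num)
  have hsq : σ j * σ j = 1 := by
    rcases hgauge j with h | h <;> rw [h] <;> norm_num
  have harg : σ i * z i - Real.sign (a i j) * (σ j * z j) = σ i * (z i - z j) := by
    rw [hsign]
    linear_combination -σ i * z j * hsq
  simp only [harg]
  rcases hgauge i with h | h <;> rw [h]
  · simp only [one_mul]
  · rw [neg_one_mul, neg_one_mul, hodd, neg_neg]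
end

section
/- Let a signed graph be structurally balanced with gauge σ, let f : ℝ → ℝ be even (f (-t) = f t for all t), and let φ be an unsigned automorphism. Then the signed relative nonlinear flow F is invariant under the induced signed automorphism: for every x : Fin n → ℝ and every vertex i, F (Φ' x) i = F x (φ i). (Theorem 5, even case.) -/
/-- On a structurally balanced signed graph, the sign of an edge is the product of the gauge
values at its endpoints. -/
theorem sign_eq_gauge_mul {ι : Type*} {a : ι → ι → ℝ} {σ : ι → ℝ}
    (hgauge : ∀ i, σ i = 1 ∨ σ i = -1) (hbal : ∀ i j, σ i * σ j * a i j ≥ 0)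
    {i j : ι} (hij : a i j ≠ 0) : Real.sign (a i j) = σ i * σ j := by
  have h := hbal i j
  rcases hij.lt_or_gt with ha | ha
  · rw [Real.sign_of_neg ha]
    rcases hgauge i with hi | hi <;> rcases hgauge j with hj | hj <;> rw [hi, hj] at h ⊢ <;> linarith
  · rw [Real.sign_of_pos ha]
    rcases hgauge i with hi | hi <;> rcases hgauge j with hj | hj <;> rw [hi, hj] at h ⊢ <;> linarith

/-- Theorem 5, even case: on a structurally balanced graph, the signed relative
nonlinear flow with even `f` is invariant under the signed automorphism induced by an
unsigned automorphism. -/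
theorem relative_flow_signed_automorphism_invariant_even
    (n : ℕ) (a : Fin n → Fin n → ℝ)
    (hsym : ∀ i j, a i j = a j i) (hdiag : ∀ i, a i i = 0)
    (σ : Fin n → ℝ) (hgauge : ∀ i, σ i = 1 ∨ σ i = -1)
    (hbal : ∀ i j, σ i * σ j * a i j ≥ 0)
    (f : ℝ → ℝ) (heven : ∀ t, f (-t) = f t)
    (φ : Equiv.Perm (Fin n))
    (haut : ∀ i j, |a (φ i) (φ j)| = |a i j|)
    (F : (Fin n → ℝ) → (Fin n → ℝ))
    (hF : ∀ x i, F x i =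
      -∑ j ∈ Finset.univ.filter (fun j => a i j ≠ 0),
        f (x i - Real.sign (a i j) * x j))
    (x : Fin n → ℝ) (i : Fin n) :
    F (fun k => σ k * σ (φ k) * x (φ k)) i = F x (φ i) := by
  have edge_iff (j : Fin n) : a i j ≠ 0 ↔ a (φ i) (φ j) ≠ 0 := by
    rw [← abs_ne_zero, ← haut, abs_ne_zero]
  rw [hF, hF]
  congr 1
  refine Finset.sum_equiv φ (by simpa using edge_iff) fun j hmem => ?_
  have hij : a i j ≠ 0 := by simpa using hmem
  rw [sign_eq_gauge_mul hgauge hbal hij, sign_eq_gauge_mul hgauge hbal ((edge_iff j).mp hij)]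
  rcases hgauge j with hj | hj <;> rcases hgauge i with hi | hi <;>
    rcases hgauge (φ i) with hk | hk <;> simp only [hi, hj, hk] <;>
    first
    | (congr 1; ring1)
    | (rw [← heven]; congr 1; ring1)
end

section
/- Let a signed graph be structurally balanced with gauge σ and let f : ℝ → ℝ be odd (f (-t) = -f t for all t). Then the gauge transformation z ↦ σ ⊙ z converts the signed disagreement nonlinear flow into the unsigned disagreement nonlinear flow: for every z : Fin n → ℝ and every vertex i, σ i * F (σ ⊙ z) i = -f (∑_{j : a i j ≠ 0} (z i - z j)), where (σ ⊙ z) j = σ j * z j. (Key identity in the proof of Theorem 6, odd case.) -/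
/-- In a balanced signed graph, the sign of every edge is the product of the gauge values
at its endpoints. -/
theorem sign_eq_mul_of_gauge {s t w : ℝ} (hs : s = 1 ∨ s = -1) (ht : t = 1 ∨ t = -1)
    (hw : w ≠ 0) (h : 0 ≤ s * t * w) : Real.sign w = s * t := by
  rcases lt_or_gt_of_ne hw with hneg | hpos
  · rw [Real.sign_of_neg hneg]
    rcases hs with rfl | rfl <;> rcases ht with rfl | rfl <;> linarith
  · rw [Real.sign_of_pos hpos]
    rcases hs with rfl | rfl <;> rcases ht with rfl | rfl <;> linarith

/-- Key identity in the proof of Theorem 6, odd case: on a structurally balanced graph,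
the gauge transformation turns the signed disagreement nonlinear flow (with odd `f`)
into the unsigned disagreement nonlinear flow. -/
theorem gauge_transforms_disagreement_flow_odd
    (n : ℕ) (a : Fin n → Fin n → ℝ)
    (hsym : ∀ i j, a i j = a j i) (hdiag : ∀ i, a i i = 0)
    (σ : Fin n → ℝ) (hgauge : ∀ i, σ i = 1 ∨ σ i = -1)
    (hbal : ∀ i j, σ i * σ j * a i j ≥ 0)
    (f : ℝ → ℝ) (hodd : ∀ t, f (-t) = -f t)
    (F : (Fin n → ℝ) → (Fin n → ℝ))
    (hF : ∀ x i, F x i =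
      -f (∑ j ∈ Finset.univ.filter (fun j => a i j ≠ 0),
        (x i - Real.sign (a i j) * x j)))
    (z : Fin n → ℝ) (i : Fin n) :
    σ i * F (fun j => σ j * z j) i =
      -f (∑ j ∈ Finset.univ.filter (fun j => a i j ≠ 0), (z i - z j)) := by
  have hsum : ∑ j ∈ Finset.univ.filter (fun j => a i j ≠ 0),
      (σ i * z i - Real.sign (a i j) * (σ j * z j)) =
      σ i * ∑ j ∈ Finset.univ.filter (fun j => a i j ≠ 0), (z i - z j) := by
    rw [Finset.mul_sum]
    refine Finset.sum_congr rfl fun j hj => ?_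
    rw [sign_eq_mul_of_gauge (hgauge i) (hgauge j) (Finset.mem_filter.mp hj).2 (hbal i j)]
    have hσ : σ j * σ j = 1 := by rcases hgauge j with h | h <;> simp [h]
    linear_combination (-(σ i * z j)) * hσ
  rw [hF, hsum]
  rcases hgauge i with h | h
  · simp only [h, one_mul]
  · simp only [h, neg_one_mul, hodd, neg_neg]
end
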